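/- arXiv:2605.20036 — 7 statements merged into one kernel-verified Lean document; each statement's English description precedes it below -/
import Mathlib

section
/- Weak duality holds for the linearized subsidy problem: for every b ∈ Ω satisfying the linearized subsidy-rate constraint Σ_{i∈I} a_i·b_i² − (C + δ)·Σ_{i∈I} r_i·a_i·b_i ≤ 0, the primal objective satisfies Σ_{i∈I} r_i·a_i·b_i ≤ L(b*), where b* is the clipped vector with b*_i = min(max(0, κ·r_i), b_max,i). -/
/-- Separable Lagrangian `L(b) = Σ_i [(1 + λ(C+δ)) r_i a_i b_i − λ a_i b_i²]`. -/
def sepLagrangian {I : Type*} [Fintype I] (C δ lam : ℝ) (r a : I → ℝ)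
    (b : I → ℝ) : ℝ :=
  ∑ i, ((1 + lam * (C + δ)) * r i * a i * b i - lam * a i * b i ^ 2)

/-- Clipping `t` to `[0, m]` maximizes the concave quadratic `x ↦ 2 t x - x²` there. -/
theorem two_mul_sub_sq_le_clip {t m x : ℝ} (hx : 0 ≤ x) (hxm : x ≤ m) :
    2 * t * x - x ^ 2 ≤ 2 * t * min (max 0 t) m - min (max 0 t) m ^ 2 := by
  rcases le_total t 0 with ht | ht
  · rw [max_eq_left ht, min_eq_left (hx.trans hxm)]
    nlinarith [mul_nonneg hx (neg_nonneg.2 ht)]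
  · rw [max_eq_right ht]
    rcases le_total t m with htm | htm
    · rw [min_eq_left htm]
      nlinarith [sq_nonneg (t - x)]
    · rw [min_eq_right htm]
      nlinarith [mul_nonneg (sub_nonneg.2 hxm) (sub_nonneg.2 htm)]

/-- The Lagrangian is the primal objective minus `lam` times the constraint function. -/
theorem sepLagrangian_eq {I : Type*} [Fintype I] (C δ lam : ℝ) (r a b : I → ℝ) :
    sepLagrangian C δ lam r a b = ∑ i, r i * a i * b i -
      lam * ((∑ i, a i * b i ^ 2) - (C + δ) * ∑ i, r i * a i * b i) := by
  simp only [sepLagrangian, Finset.mul_sum, ← Finset.sum_sub_distrib]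
  exact Finset.sum_congr rfl fun i _ => by ring

/-- The clipped vector maximizes the Lagrangian over the box. -/
theorem sepLagrangian_le_clip {I : Type*} [Fintype I] (C δ : ℝ) {lam : ℝ} (hlam : 0 < lam)
    (r : I → ℝ) {a bmax b : I → ℝ} (ha : ∀ i, 0 < a i) (hb : ∀ i, 0 ≤ b i ∧ b i ≤ bmax i) :
    sepLagrangian C δ lam r a b ≤ sepLagrangian C δ lam r a
      (fun i => min (max 0 (((C + δ + 1 / lam) / 2) * r i)) (bmax i)) := by
  refine Finset.sum_le_sum fun i _ => ?_
  have quadratic_form (x : ℝ) :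
      (1 + lam * (C + δ)) * r i * a i * x - lam * a i * x ^ 2 =
        lam * a i * (2 * (((C + δ + 1 / lam) / 2) * r i) * x - x ^ 2) := by
    field_simp
    ring
  rw [quadratic_form, quadratic_form]
  exact mul_le_mul_of_nonneg_left (two_mul_sub_sq_le_clip (hb i).1 (hb i).2)
    (mul_pos hlam (ha i)).le

/-- Weak duality: every point of the box satisfying the linearized subsidy-rate
constraint has primal objective bounded by the Lagrangian value at the clipped
vector `b*`. -/
theorem weak_duality {I : Type*} [Fintype I]
    (C δ lam : ℝ) (hC : 0 ≤ C) (hδ : 0 ≤ δ) (hlam : 0 < lam)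
    (r a bmax : I → ℝ) (ha : ∀ i, 0 < a i) (hbmax : ∀ i, 0 ≤ bmax i) :
    ∀ b : I → ℝ, (∀ i, 0 ≤ b i ∧ b i ≤ bmax i) →
      (∑ i, a i * b i ^ 2) - (C + δ) * ∑ i, r i * a i * b i ≤ 0 →
      ∑ i, r i * a i * b i ≤
        sepLagrangian C δ lam r a
          (fun i => min (max 0 (((C + δ + 1 / lam) / 2) * r i)) (bmax i)) := by
  intro b hb hcon
  refine le_trans ?_ (sepLagrangian_le_clip C δ hlam r ha hb)
  rw [sepLagrangian_eq]
  linarith [mul_nonpos_of_nonneg_of_nonpos hlam.le hcon]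
end

section
/- F is strictly decreasing on the region where the bracket is nonnegative: for all b₁, b₂ with 0 ≤ b₁ < b₂ ≤ b_max and B(b₂) ≥ 0, one has F(b₁) > F(b₂). -/
/-- The bracket term `B(b) = (1 + λ·(C+δ))·r − λ·b`. -/
def bracket (C δ lam r : ℝ) (b : ℝ) : ℝ := (1 + lam * (C + δ)) * r - lam * b

/-- The first-order-condition function `F(b) = B(b)·p'(b) − λ·p(b)`. -/
def focF (C δ lam r : ℝ) (p p' : ℝ → ℝ) (b : ℝ) : ℝ :=
  bracket C δ lam r b * p' b - lam * p b

/-- The per-pair objective `Φ(b) = B(b)·p(b)`. -/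
def objPhi (C δ lam r : ℝ) (p : ℝ → ℝ) (b : ℝ) : ℝ :=
  bracket C δ lam r b * p b

/-- `F` is strictly decreasing on the region where the bracket is nonnegative. -/
theorem focF_strict_anti_on_nonneg_bracket
    (C δ lam r bmax : ℝ) (hC : 0 ≤ C) (hδ : 0 ≤ δ) (hlam : 0 < lam)
    (hbmax : 0 < bmax) (p p' : ℝ → ℝ) (hp0 : p 0 = 0)
    (hderiv : ∀ b ∈ Set.Icc (0 : ℝ) bmax,
      HasDerivWithinAt p (p' b) (Set.Icc (0 : ℝ) bmax) b)
    (hp'nonneg : ∀ b ∈ Set.Icc (0 : ℝ) bmax, 0 ≤ p' b)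
    (hp'anti : AntitoneOn p' (Set.Icc (0 : ℝ) bmax))
    (hpmono : StrictMonoOn p (Set.Icc (0 : ℝ) bmax)) :
    ∀ b₁ b₂ : ℝ, 0 ≤ b₁ → b₁ < b₂ → b₂ ≤ bmax → 0 ≤ bracket C δ lam r b₂ →
      focF C δ lam r p p' b₂ < focF C δ lam r p p' b₁ := by
  intro b₁ b₂ h₁ h₁₂ h₂ hB
  have hm₁ : b₁ ∈ Set.Icc (0 : ℝ) bmax := ⟨h₁, h₁₂.le.trans h₂⟩
  have hm₂ : b₂ ∈ Set.Icc (0 : ℝ) bmax := ⟨h₁.trans h₁₂.le, h₂⟩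
  have hB₁₂ : bracket C δ lam r b₂ ≤ bracket C δ lam r b₁ := by
    unfold bracket
    gcongr
  have hprod : bracket C δ lam r b₂ * p' b₂ ≤ bracket C δ lam r b₁ * p' b₁ :=
    mul_le_mul hB₁₂ (hp'anti hm₁ hm₂ h₁₂.le) (hp'nonneg b₂ hm₂) (hB.trans hB₁₂)
  have hp : lam * p b₁ < lam * p b₂ :=
    mul_lt_mul_of_pos_left (hpmono hm₁ hm₂ h₁₂) hlam
  unfold focF
  linarith
end

section
/- The first-order-condition equation F(b) = 0 has at most one solution in the open interval (0, b_max): if b₁, b₂ ∈ (0, b_max) satisfy F(b₁) = 0 and F(b₂) = 0, then b₁ = b₂. -/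
/-- The first-order-condition equation `F(b) = 0` has at most one solution in
the open interval `(0, b_max)`. -/
theorem focF_root_unique
    (C δ lam r bmax : ℝ) (hC : 0 ≤ C) (hδ : 0 ≤ δ) (hlam : 0 < lam)
    (hbmax : 0 < bmax) (p p' : ℝ → ℝ) (hp0 : p 0 = 0)
    (hderiv : ∀ b ∈ Set.Icc (0 : ℝ) bmax,
      HasDerivWithinAt p (p' b) (Set.Icc (0 : ℝ) bmax) b)
    (hp'nonneg : ∀ b ∈ Set.Icc (0 : ℝ) bmax, 0 ≤ p' b)
    (hp'anti : AntitoneOn p' (Set.Icc (0 : ℝ) bmax))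
    (hpmono : StrictMonoOn p (Set.Icc (0 : ℝ) bmax)) :
    ∀ b₁ ∈ Set.Ioo (0 : ℝ) bmax, ∀ b₂ ∈ Set.Ioo (0 : ℝ) bmax,
      focF C δ lam r p p' b₁ = 0 → focF C δ lam r p p' b₂ = 0 → b₁ = b₂ := by
  have no_two_roots : ∀ x ∈ Set.Ioo (0 : ℝ) bmax, ∀ y ∈ Set.Ioo (0 : ℝ) bmax,
      focF C δ lam r p p' x = 0 → focF C δ lam r p p' y = 0 → ¬ x < y := by
    intro x hx y hy hFx hFy hxy
    have hxI := Set.Ioo_subset_Icc_self hx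
    have hyI := Set.Ioo_subset_Icc_self hy
    have hpy : 0 < p y := by
      have h := hpmono (Set.left_mem_Icc.mpr hbmax.le) hyI hy.1
      rwa [hp0] at h
    have hBp'x : bracket C δ lam r x * p' x = lam * p x := sub_eq_zero.mp hFx
    have hBp'y : bracket C δ lam r y * p' y = lam * p y := sub_eq_zero.mp hFy
    have hBy : 0 < bracket C δ lam r y :=
      pos_of_mul_pos_left (hBp'y ▸ mul_pos hlam hpy) (hp'nonneg y hyI)
    have hB : bracket C δ lam r y ≤ bracket C δ lam r x :=
      sub_le_sub_left (mul_le_mul_of_nonneg_left hxy.le hlam.le) _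
    have h : lam * p y ≤ lam * p x := calc
      lam * p y = bracket C δ lam r y * p' y := hBp'y.symm
      _ ≤ bracket C δ lam r x * p' x :=
        mul_le_mul hB (hp'anti hxI hyI hxy.le) (hp'nonneg y hyI) (hBy.le.trans hB)
      _ = lam * p x := hBp'x
    exact (hpmono hxI hyI hxy).not_ge (le_of_mul_le_mul_left h hlam)
  intro b₁ hb₁ b₂ hb₂ h₁ h₂
  exact le_antisymm (not_lt.mp (no_two_roots b₂ hb₂ b₁ hb₁ h₂ h₁))
    (not_lt.mp (no_two_roots b₁ hb₁ b₂ hb₂ h₁ h₂))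
end

section
/- If b° ∈ (0, b_max) satisfies F(b°) = 0, then F is positive strictly before the root and negative strictly after: F(b) > 0 for every b ∈ (0, b°) and F(b) < 0 for every b ∈ (b°, b_max]. -/
/-- If `b° ∈ (0, b_max)` is a root of `F`, then `F` is positive strictly before
the root and negative strictly after it. -/
theorem focF_sign_around_root
    (C δ lam r bmax : ℝ) (hC : 0 ≤ C) (hδ : 0 ≤ δ) (hlam : 0 < lam)
    (hbmax : 0 < bmax) (p p' : ℝ → ℝ) (hp0 : p 0 = 0)
    (hderiv : ∀ b ∈ Set.Icc (0 : ℝ) bmax,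
      HasDerivWithinAt p (p' b) (Set.Icc (0 : ℝ) bmax) b)
    (hp'nonneg : ∀ b ∈ Set.Icc (0 : ℝ) bmax, 0 ≤ p' b)
    (hp'anti : AntitoneOn p' (Set.Icc (0 : ℝ) bmax))
    (hpmono : StrictMonoOn p (Set.Icc (0 : ℝ) bmax)) :
    ∀ b₀ ∈ Set.Ioo (0 : ℝ) bmax, focF C δ lam r p p' b₀ = 0 →
      (∀ b ∈ Set.Ioo (0 : ℝ) b₀, 0 < focF C δ lam r p p' b) ∧
      (∀ b : ℝ, b₀ < b → b ≤ bmax → focF C δ lam r p p' b < 0) := by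
  rintro b₀ ⟨hb₀, hb₀max⟩ hroot
  have hmem : b₀ ∈ Set.Icc (0 : ℝ) bmax := ⟨hb₀.le, hb₀max.le⟩
  have hp_pos : 0 < p b₀ := by
    simpa [hp0] using hpmono ⟨le_rfl, hbmax.le⟩ hmem hb₀
  have hroot_eq : bracket C δ lam r b₀ * p' b₀ = lam * p b₀ := sub_eq_zero.mp hroot
  have hprod : 0 < bracket C δ lam r b₀ * p' b₀ := hroot_eq ▸ mul_pos hlam hp_pos
  have hB_pos : 0 < bracket C δ lam r b₀ := pos_of_mul_pos_left hprod (hp'nonneg b₀ hmem)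
  have hB_anti {x y : ℝ} (hxy : x ≤ y) : bracket C δ lam r y ≤ bracket C δ lam r x :=
    sub_le_sub_left (mul_le_mul_of_nonneg_left hxy hlam.le) _
  constructor
  · rintro b ⟨hb, hlt⟩
    have hbmem : b ∈ Set.Icc (0 : ℝ) bmax := ⟨hb.le, (hlt.trans hb₀max).le⟩
    refine sub_pos.mpr ?_
    calc lam * p b < lam * p b₀ := mul_lt_mul_of_pos_left (hpmono hbmem hmem hlt) hlam
      _ = bracket C δ lam r b₀ * p' b₀ := hroot_eq.symm
      _ ≤ bracket C δ lam r b * p' b :=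
        mul_le_mul (hB_anti hlt.le) (hp'anti hbmem hmem hlt.le) (hp'nonneg b₀ hmem)
          (hB_pos.le.trans (hB_anti hlt.le))
  · intro b hlt hbm
    have hbmem : b ∈ Set.Icc (0 : ℝ) bmax := ⟨(hb₀.trans hlt).le, hbm⟩
    refine sub_neg.mpr ?_
    calc bracket C δ lam r b * p' b ≤ bracket C δ lam r b₀ * p' b₀ :=
        mul_le_mul (hB_anti hlt.le) (hp'anti hmem hbmem hlt.le) (hp'nonneg b hbmem) hB_pos.le
      _ = lam * p b₀ := hroot_eq
      _ < lam * p b := mul_lt_mul_of_pos_left (hpmono hmem hbmem hlt) hlam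
end

section
/- If b° ∈ (0, b_max) satisfies F(b°) = 0, then b° maximizes the per-pair objective Φ on [0, b_max]: Φ(b) ≤ Φ(b°) for every b ∈ [0, b_max]. -/
/-- A function whose derivative is antitone on an interval lies below its tangent lines. -/
theorem le_tangent_of_antitoneOn_deriv {f f' : ℝ → ℝ} {l u : ℝ}
    (hf : ∀ x ∈ Set.Icc l u, HasDerivWithinAt f (f' x) (Set.Icc l u) x)
    (hf' : AntitoneOn f' (Set.Icc l u)) {x y : ℝ}
    (hx : x ∈ Set.Icc l u) (hy : y ∈ Set.Icc l u) :
    f y ≤ f x + f' x * (y - x) := by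
  have mean_value : ∀ a ∈ Set.Icc l u, ∀ b ∈ Set.Icc l u, a < b →
      ∃ c ∈ Set.Ioo a b, f b - f a = f' c * (b - a) := by
    intro a ha b hb hab
    obtain ⟨c, hc, hslope⟩ := exists_hasDerivAt_eq_slope f f' hab
      (fun z hz => ((hf z ⟨ha.1.trans hz.1, hz.2.trans hb.2⟩).continuousWithinAt).mono
        (Set.Icc_subset_Icc ha.1 hb.2))
      (fun z hz => (hf z ⟨ha.1.trans hz.1.le, hz.2.le.trans hb.2⟩).hasDerivAt
        (Icc_mem_nhds (ha.1.trans_lt hz.1) (hz.2.trans_le hb.2)))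
    exact ⟨c, hc, by rw [hslope, div_mul_cancel₀ _ (sub_pos.2 hab).ne']⟩
  rcases lt_trichotomy x y with h | rfl | h
  · obtain ⟨c, hc, hfc⟩ := mean_value x hx y hy h
    have hle : f' c ≤ f' x := hf' hx ⟨hx.1.trans hc.1.le, hc.2.le.trans hy.2⟩ hc.1.le
    have := mul_le_mul_of_nonneg_right hle (sub_pos.2 h).le
    linarith
  · simp
  · obtain ⟨c, hc, hfc⟩ := mean_value y hy x hx h
    have hle : f' x ≤ f' c := hf' ⟨hy.1.trans hc.1.le, hc.2.le.trans hx.2⟩ hx hc.2.le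
    have := mul_le_mul_of_nonneg_right hle (sub_pos.2 h).le
    linarith

/-- An interior root `b°` of `F` maximizes the per-pair objective `Φ` on `[0, b_max]`. -/
theorem interior_root_maximizes
    (C δ lam r bmax : ℝ) (hC : 0 ≤ C) (hδ : 0 ≤ δ) (hlam : 0 < lam)
    (hbmax : 0 < bmax) (p p' : ℝ → ℝ) (hp0 : p 0 = 0)
    (hderiv : ∀ b ∈ Set.Icc (0 : ℝ) bmax,
      HasDerivWithinAt p (p' b) (Set.Icc (0 : ℝ) bmax) b)
    (hp'nonneg : ∀ b ∈ Set.Icc (0 : ℝ) bmax, 0 ≤ p' b)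
    (hp'anti : AntitoneOn p' (Set.Icc (0 : ℝ) bmax))
    (hpmono : StrictMonoOn p (Set.Icc (0 : ℝ) bmax)) :
    ∀ b₀ ∈ Set.Ioo (0 : ℝ) bmax, focF C δ lam r p p' b₀ = 0 →
      ∀ b ∈ Set.Icc (0 : ℝ) bmax,
        objPhi C δ lam r p b ≤ objPhi C δ lam r p b₀ := by
  intro b₀ hb₀ hfoc b hb
  have hb₀' : b₀ ∈ Set.Icc (0 : ℝ) bmax := Set.Ioo_subset_Icc_self hb₀
  have zero_mem : (0 : ℝ) ∈ Set.Icc (0 : ℝ) bmax := ⟨le_rfl, hbmax.le⟩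
  have hp₀ : 0 < p b₀ := hp0 ▸ hpmono zero_mem hb₀' hb₀.1
  have hp : 0 ≤ p b := hp0 ▸ hpmono.monotoneOn zero_mem hb hb.1
  have hd := hp'nonneg b₀ hb₀'
  have htan := le_tangent_of_antitoneOn_deriv hderiv hp'anti hb₀' hb
  have hroot : bracket C δ lam r b₀ * p' b₀ = lam * p b₀ := sub_eq_zero.1 hfoc
  have hB₀ : 0 < bracket C δ lam r b₀ :=
    pos_of_mul_pos_left (hroot ▸ mul_pos hlam hp₀) hd
  have hB : bracket C δ lam r b = bracket C δ lam r b₀ - lam * (b - b₀) := by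
    unfold bracket
    ring
  unfold objPhi
  rcases le_total (bracket C δ lam r b) 0 with h | h
  · exact (mul_nonpos_of_nonpos_of_nonneg h hp).trans (mul_pos hB₀ hp₀).le
  · calc bracket C δ lam r b * p b
        ≤ bracket C δ lam r b * (p b₀ + p' b₀ * (b - b₀)) :=
          mul_le_mul_of_nonneg_left htan h
      _ = bracket C δ lam r b₀ * p b₀ - lam * p' b₀ * (b - b₀) ^ 2 := by
          rw [hB]
          linear_combination (b - b₀) * hroot
      _ ≤ bracket C δ lam r b₀ * p b₀ :=
          sub_le_self _ (mul_nonneg (mul_nonneg hlam.le hd) (sq_nonneg _))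
end

section
/- If F(b_max) ≥ 0, then F(b) ≥ 0 for every b ∈ [0, b_max] and the upper endpoint b_max maximizes Φ on [0, b_max]: Φ(b) ≤ Φ(b_max) for every b ∈ [0, b_max]. -/
/-- If `F(b_max) ≥ 0` then `F ≥ 0` on `[0, b_max]` and the upper endpoint
`b_max` maximizes `Φ` on `[0, b_max]`. -/
theorem upper_endpoint_maximizes
    (C δ lam r bmax : ℝ) (hC : 0 ≤ C) (hδ : 0 ≤ δ) (hlam : 0 < lam)
    (hbmax : 0 < bmax) (p p' : ℝ → ℝ) (hp0 : p 0 = 0)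
    (hderiv : ∀ b ∈ Set.Icc (0 : ℝ) bmax,
      HasDerivWithinAt p (p' b) (Set.Icc (0 : ℝ) bmax) b)
    (hp'nonneg : ∀ b ∈ Set.Icc (0 : ℝ) bmax, 0 ≤ p' b)
    (hp'anti : AntitoneOn p' (Set.Icc (0 : ℝ) bmax))
    (hpmono : StrictMonoOn p (Set.Icc (0 : ℝ) bmax)) :
    0 ≤ focF C δ lam r p p' bmax →
      (∀ b ∈ Set.Icc (0 : ℝ) bmax, 0 ≤ focF C δ lam r p p' b) ∧
      (∀ b ∈ Set.Icc (0 : ℝ) bmax,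
        objPhi C δ lam r p b ≤ objPhi C δ lam r p bmax) := by
  intro hF
  have hmax : bmax ∈ Set.Icc (0 : ℝ) bmax := ⟨hbmax.le, le_rfl⟩
  have hp_pos : 0 < p bmax := hp0 ▸ hpmono ⟨le_rfl, hbmax.le⟩ hmax hbmax
  have hB_max : 0 < bracket C δ lam r bmax := by
    have hprod : 0 < bracket C δ lam r bmax * p' bmax := by
      have := mul_pos hlam hp_pos
      unfold focF at hF
      linarith
    exact pos_of_mul_pos_left hprod (hp'nonneg bmax hmax)
  have hF_nonneg : ∀ b ∈ Set.Icc (0 : ℝ) bmax, 0 ≤ focF C δ lam r p p' b := by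
    intro b hb
    have hB : bracket C δ lam r bmax ≤ bracket C δ lam r b := by
      have := mul_le_mul_of_nonneg_left hb.2 hlam.le
      unfold bracket
      linarith
    have hBp' : bracket C δ lam r bmax * p' bmax ≤ bracket C δ lam r b * p' b :=
      mul_le_mul hB (hp'anti hb hmax hb.2) (hp'nonneg bmax hmax) (hB_max.le.trans hB)
    have hp : lam * p b ≤ lam * p bmax :=
      mul_le_mul_of_nonneg_left (hpmono.monotoneOn hb hmax hb.2) hlam.le
    unfold focF at hF ⊢
    linarith
  refine ⟨hF_nonneg, ?_⟩
  have hΦ : ∀ b ∈ Set.Icc (0 : ℝ) bmax, HasDerivWithinAt (objPhi C δ lam r p)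
      (focF C δ lam r p p' b) (Set.Icc (0 : ℝ) bmax) b := by
    intro b hb
    have hB : HasDerivWithinAt (bracket C δ lam r) (-lam) (Set.Icc (0 : ℝ) bmax) b := by
      have h := ((hasDerivWithinAt_id b (Set.Icc (0 : ℝ) bmax)).const_mul lam).const_sub
        ((1 + lam * (C + δ)) * r)
      rw [mul_one] at h
      exact h
    exact (hB.mul (hderiv b hb)).congr_deriv (by unfold focF; ring)
  have hmono : MonotoneOn (objPhi C δ lam r p) (Set.Icc (0 : ℝ) bmax) :=
    monotoneOn_of_hasDerivWithinAt_nonneg (convex_Icc 0 bmax)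
      (fun b hb => (hΦ b hb).continuousWithinAt)
      (fun b hb => (hΦ b (interior_subset hb)).mono interior_subset)
      (fun b hb => hF_nonneg b (interior_subset hb))
  exact fun b hb => hmono hb hmax hb.2
end

section
/- If F(0) ≤ 0, then F(b) < 0 for every b ∈ (0, b_max] and the lower endpoint 0 maximizes Φ on [0, b_max]: Φ(b) ≤ Φ(0) for every b ∈ [0, b_max]. -/
/-- A strictly increasing function on `[0, b]` whose derivative is nonincreasing has positive
derivative at `0`. -/
lemma deriv_zero_pos_of_strictMonoOn {b : ℝ} (hb : 0 < b) {p p' : ℝ → ℝ}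
    (hderiv : ∀ x ∈ Set.Icc (0 : ℝ) b, HasDerivWithinAt p (p' x) (Set.Icc (0 : ℝ) b) x)
    (hanti : AntitoneOn p' (Set.Icc (0 : ℝ) b))
    (hmono : StrictMonoOn p (Set.Icc (0 : ℝ) b)) : 0 < p' 0 := by
  have h0 : (0 : ℝ) ∈ Set.Icc (0 : ℝ) b := Set.left_mem_Icc.2 hb.le
  obtain ⟨c, hc, hslope⟩ := exists_hasDerivAt_eq_slope p p' hb
    (fun x hx => (hderiv x hx).continuousWithinAt)
    (fun x hx => (hderiv x (Set.Ioo_subset_Icc_self hx)).hasDerivAt (Icc_mem_nhds hx.1 hx.2))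
  have hpos : 0 < p' c := by
    rw [hslope]
    exact div_pos (sub_pos.2 (hmono h0 (Set.right_mem_Icc.2 hb.le) hb)) (sub_pos.2 hb)
  exact hpos.trans_le (hanti h0 (Set.Ioo_subset_Icc_self hc) hc.1.le)

/-- If `F(0) ≤ 0` then `F < 0` on `(0, b_max]` and the lower endpoint `0`
maximizes `Φ` on `[0, b_max]`. -/
theorem lower_endpoint_maximizes
    (C δ lam r bmax : ℝ) (hC : 0 ≤ C) (hδ : 0 ≤ δ) (hlam : 0 < lam)
    (hbmax : 0 < bmax) (p p' : ℝ → ℝ) (hp0 : p 0 = 0)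
    (hderiv : ∀ b ∈ Set.Icc (0 : ℝ) bmax,
      HasDerivWithinAt p (p' b) (Set.Icc (0 : ℝ) bmax) b)
    (hp'nonneg : ∀ b ∈ Set.Icc (0 : ℝ) bmax, 0 ≤ p' b)
    (hp'anti : AntitoneOn p' (Set.Icc (0 : ℝ) bmax))
    (hpmono : StrictMonoOn p (Set.Icc (0 : ℝ) bmax)) :
    focF C δ lam r p p' 0 ≤ 0 →
      (∀ b : ℝ, 0 < b → b ≤ bmax → focF C δ lam r p p' b < 0) ∧
      (∀ b ∈ Set.Icc (0 : ℝ) bmax,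
        objPhi C δ lam r p b ≤ objPhi C δ lam r p 0) := by
  intro hF
  have hpos := deriv_zero_pos_of_strictMonoOn hbmax hderiv hp'anti hpmono
  have hB0 : bracket C δ lam r 0 ≤ 0 := by
    simp only [focF, hp0, mul_zero, sub_zero] at hF
    exact nonpos_of_mul_nonpos_left hF hpos
  have h0 : (0 : ℝ) ∈ Set.Icc (0 : ℝ) bmax := Set.left_mem_Icc.2 hbmax.le
  have hB : ∀ b : ℝ, 0 ≤ b → bracket C δ lam r b ≤ 0 := by
    intro b hb
    have := mul_nonneg hlam.le hb
    simp only [bracket] at hB0 ⊢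
    linarith
  refine ⟨fun b hb hbm => ?_, fun b hb => ?_⟩
  · have hmem : b ∈ Set.Icc (0 : ℝ) bmax := ⟨hb.le, hbm⟩
    have hpb : 0 < p b := hp0 ▸ hpmono h0 hmem hb
    have h1 := mul_nonpos_of_nonpos_of_nonneg (hB b hb.le) (hp'nonneg b hmem)
    have h2 := mul_pos hlam hpb
    simp only [focF]
    linarith
  · have hpb : 0 ≤ p b := hp0 ▸ hpmono.monotoneOn h0 hb hb.1
    simp only [objPhi, hp0, mul_zero]
    exact mul_nonpos_of_nonpos_of_nonneg (hB b hb.1) hpb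
end
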